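/- arXiv:1211.4346 — 3 statements merged into one kernel-verified Lean document; each statement's English description precedes it below -/
import Mathlib

section
/- For any measurable sets A, B ∈ 𝓑, the pointwise limits u(·;A) and w(·;A,B) satisfy the Bellman fixpoint equations: u(x;A) = (I_A u(·;A))(x) for all x ∈ X, and w(x;A,B) = 1_B(x) + (I_{A\B} w(·;A,B))(x) for all x ∈ X. -/
open MeasureTheory ProbabilityTheory

variable {X : Type*} [MeasurableSpace X]

/-- Transition operator: `(Pf)(x) = ∫ f(y) P(x,dy)`. -/
noncomputable def transOp (P : Kernel X X) (f : X → ℝ) : X → ℝ :=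
  fun x => ∫ y, f y ∂(P x)

/-- Invariance operator `I_A f = 1_A · (Pf)`. -/
noncomputable def invOp (P : Kernel X X) (A : Set X) (f : X → ℝ) : X → ℝ :=
  A.indicator (transOp P f)

/-- Invariance value functions `u_n(·;A)`. -/
noncomputable def uN (P : Kernel X X) (A : Set X) : ℕ → X → ℝ
  | 0 => A.indicator 1
  | n + 1 => invOp P A (uN P A n)

/-- `u(x;A) = lim_n u_n(x;A)` (the sequence is pointwise nonincreasing). -/
noncomputable def uFun (P : Kernel X X) (A : Set X) : X → ℝ :=
  fun x => ⨅ n, uN P A n x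

/-- Reach-avoid value functions `w_n(·;A,B)`. -/
noncomputable def wN (P : Kernel X X) (A B : Set X) : ℕ → X → ℝ
  | 0 => B.indicator 1
  | n + 1 => fun x => B.indicator 1 x + invOp P (A \ B) (wN P A B n) x

/-- `w(x;A,B) = lim_n w_n(x;A,B)` (the sequence is pointwise nondecreasing, in `[0,1]`). -/
noncomputable def wFun (P : Kernel X X) (A B : Set X) : X → ℝ :=
  fun x => ⨆ n, wN P A B n x

/-- A bounded function. -/
def BddFun (f : X → ℝ) : Prop := ∃ C : ℝ, ∀ x, |f x| ≤ C

/-- A set `S` is absorbing if `P(x,S) = 1` for all `x ∈ S`. -/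
def Absorbing (P : Kernel X X) (S : Set X) : Prop := ∀ x ∈ S, P x S = 1

/-- A set is simple if its only absorbing measurable subset is empty. -/
def Simple (P : Kernel X X) (A : Set X) : Prop :=
  ∀ S ⊆ A, MeasurableSet S → Absorbing P S → S = ∅


/-- A measurable function with values in `[0,1]`. -/
def UnitMeas (f : X → ℝ) : Prop := Measurable f ∧ ∀ x, f x ∈ Set.Icc (0 : ℝ) 1

lemma UnitMeas.integrable {f : X → ℝ} (hf : UnitMeas f) (μ : Measure X) [IsFiniteMeasure μ] :
    Integrable f μ :=
  Integrable.of_mem_Icc 0 1 hf.1.aemeasurable (ae_of_all _ hf.2)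

lemma unitMeas_indicator_one {A : Set X} (hA : MeasurableSet A) :
    UnitMeas (A.indicator (1 : X → ℝ)) := by
  refine ⟨measurable_one.indicator hA, fun x => ?_⟩
  by_cases hx : x ∈ A <;> simp [hx]

lemma UnitMeas.transOp_mem {f : X → ℝ} (hf : UnitMeas f) (P : Kernel X X) [IsMarkovKernel P]
    (x : X) : transOp P f x ∈ Set.Icc (0 : ℝ) 1 := by
  refine ⟨integral_nonneg fun y => (hf.2 y).1, ?_⟩
  calc transOp P f x ≤ ∫ _, (1 : ℝ) ∂(P x) :=
        integral_mono (hf.integrable _) (integrable_const _) fun y => (hf.2 y).2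
    _ = 1 := by simp

lemma UnitMeas.invOp {f : X → ℝ} (hf : UnitMeas f) (P : Kernel X X) [IsMarkovKernel P]
    {A : Set X} (hA : MeasurableSet A) : UnitMeas (invOp P A f) := by
  refine ⟨Measurable.indicator ?_ hA, fun x => ?_⟩
  · exact (hf.1.stronglyMeasurable.integral_kernel (κ := P)).measurable
  · by_cases hx : x ∈ A
    · simpa only [_root_.invOp, Set.indicator_of_mem hx] using hf.transOp_mem P x
    · simp [_root_.invOp, hx]

lemma invOp_mono {f g : X → ℝ} (hf : UnitMeas f) (hg : UnitMeas g) (hfg : f ≤ g)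
    (P : Kernel X X) [IsMarkovKernel P] (A : Set X) : invOp P A f ≤ invOp P A g :=
  fun _ => Set.indicator_le_indicator' fun _ => integral_mono (hf.integrable _) (hg.integrable _) hfg

lemma tendsto_invOp {f : ℕ → X → ℝ} {g : X → ℝ} (hf : ∀ n, UnitMeas (f n))
    (hlim : ∀ x, Filter.Tendsto (f · x) Filter.atTop (nhds (g x)))
    (P : Kernel X X) [IsMarkovKernel P] (A : Set X) (x : X) :
    Filter.Tendsto (fun n => invOp P A (f n) x) Filter.atTop (nhds (invOp P A g x)) := by
  by_cases hx : x ∈ A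
  · simp only [invOp, Set.indicator_of_mem hx]
    refine tendsto_integral_of_dominated_convergence (fun _ => 1)
      (fun n => (hf n).1.aestronglyMeasurable) (integrable_const _) (fun n => ae_of_all _ fun y => ?_)
      (ae_of_all _ hlim)
    rw [Real.norm_of_nonneg ((hf n).2 y).1]
    exact ((hf n).2 y).2
  · simp [invOp, hx]

lemma unitMeas_uN (P : Kernel X X) [IsMarkovKernel P] {A : Set X} (hA : MeasurableSet A) (n : ℕ) :
    UnitMeas (uN P A n) := by
  induction n with
  | zero => exact unitMeas_indicator_one hA
  | succ n ih => exact ih.invOp P hA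

lemma antitone_uN (P : Kernel X X) [IsMarkovKernel P] {A : Set X} (hA : MeasurableSet A) :
    Antitone (uN P A) := by
  refine antitone_nat_of_succ_le fun n => ?_
  induction n with
  | zero =>
    exact fun x => Set.indicator_le_indicator' fun _ => ((unitMeas_uN P hA 0).transOp_mem P x).2
  | succ n ih => exact invOp_mono (unitMeas_uN P hA _) (unitMeas_uN P hA _) ih P A

lemma tendsto_uN (P : Kernel X X) [IsMarkovKernel P] {A : Set X} (hA : MeasurableSet A) (x : X) :
    Filter.Tendsto (uN P A · x) Filter.atTop (nhds (uFun P A x)) :=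
  tendsto_atTop_ciInf (fun _ _ h => antitone_uN P hA h x)
    ⟨0, Set.forall_mem_range.2 fun n => ((unitMeas_uN P hA n).2 x).1⟩

lemma unitMeas_wN (P : Kernel X X) [IsMarkovKernel P] {A B : Set X} (hA : MeasurableSet A)
    (hB : MeasurableSet B) (n : ℕ) : UnitMeas (wN P A B n) := by
  induction n with
  | zero => exact unitMeas_indicator_one hB
  | succ n ih =>
    have h := ih.invOp P (hA.diff hB)
    refine ⟨(unitMeas_indicator_one hB).1.add h.1, fun x => ?_⟩
    by_cases hx : x ∈ B
    · simp [wN, invOp, hx]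
    · simpa [wN, hx] using h.2 x

lemma monotone_wN (P : Kernel X X) [IsMarkovKernel P] {A B : Set X} (hA : MeasurableSet A)
    (hB : MeasurableSet B) : Monotone (wN P A B) := by
  refine monotone_nat_of_le_succ fun n => ?_
  induction n with
  | zero =>
    exact fun x => le_add_of_nonneg_right
      (((unitMeas_wN P hA hB 0).invOp P (hA.diff hB)).2 x).1
  | succ n ih =>
    exact fun x => add_le_add_right
      (invOp_mono (unitMeas_wN P hA hB _) (unitMeas_wN P hA hB _) ih P (A \ B) x) _

lemma tendsto_wN (P : Kernel X X) [IsMarkovKernel P] {A B : Set X} (hA : MeasurableSet A)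
    (hB : MeasurableSet B) (x : X) :
    Filter.Tendsto (wN P A B · x) Filter.atTop (nhds (wFun P A B x)) :=
  tendsto_atTop_ciSup (fun _ _ h => monotone_wN P hA hB h x)
    ⟨1, Set.forall_mem_range.2 fun n => ((unitMeas_wN P hA hB n).2 x).2⟩

/-- the limit value functions satisfy the Bellman fixpoint equations:
`u(x;A) = (I_A u(·;A))(x)` and `w(x;A,B) = 1_B(x) + (I_{A\B} w(·;A,B))(x)` for all `x`. -/
theorem stmt1 (P : Kernel X X) [IsMarkovKernel P] (A B : Set X)
    (hA : MeasurableSet A) (hB : MeasurableSet B) :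
    (∀ x : X, uFun P A x = invOp P A (uFun P A) x) ∧
      (∀ x : X, wFun P A B x = B.indicator 1 x + invOp P (A \ B) (wFun P A B) x) := by
  refine ⟨fun x => ?_, fun x => ?_⟩
  · exact tendsto_nhds_unique ((Filter.tendsto_add_atTop_iff_nat 1).2 (tendsto_uN P hA x))
      (tendsto_invOp (unitMeas_uN P hA) (tendsto_uN P hA) P A x)
  · exact tendsto_nhds_unique ((Filter.tendsto_add_atTop_iff_nat 1).2 (tendsto_wN P hA hB x))
      ((tendsto_invOp (unitMeas_wN P hA hB) (tendsto_wN P hA hB) P (A \ B) x).const_add _)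
end

section
/- Let A ∈ 𝓑 be nonempty and suppose m := m(A) < ∞ (so m ≥ 1), and set ρ := ρ(A). Then for every n ∈ ℕ one has sup_{x∈X} u_n(x;A) ≤ ρ^⌊n/m⌋, and consequently u(x;A) = 0 for all x ∈ X. -/
open MeasureTheory ProbabilityTheory

variable {X : Type*} [MeasurableSpace X]

section InvarianceValue

variable (P : Kernel X X) {A : Set X}

theorem measurable_uN (hA : MeasurableSet A) (n : ℕ) : Measurable (uN P A n) := by
  induction n with
  | zero => exact measurable_one.indicator hA
  | succ n ih =>
    exact (ih.stronglyMeasurable.integral_kernel (κ := P)).measurable.indicator hA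

theorem uN_nonneg (n : ℕ) (x : X) : 0 ≤ uN P A n x := by
  induction n generalizing x with
  | zero => exact Set.indicator_nonneg (fun _ _ => zero_le_one) x
  | succ n ih => exact Set.indicator_nonneg (fun _ _ => integral_nonneg ih) x

theorem uN_eq_zero_of_notMem {x : X} (hx : x ∉ A) (n : ℕ) : uN P A n x = 0 := by
  cases n <;> exact Set.indicator_of_notMem hx _

variable [IsMarkovKernel P]

theorem uN_le_one (n : ℕ) (x : X) : uN P A n x ≤ 1 := by
  induction n generalizing x with
  | zero => exact Set.indicator_le_self' (fun _ _ => zero_le_one) x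
  | succ n ih =>
    refine Set.indicator_apply_le' (fun _ => ?_) (fun _ => zero_le_one)
    calc ∫ y, uN P A n y ∂(P x) ≤ ∫ _, (1 : ℝ) ∂(P x) :=
          integral_mono_of_nonneg (.of_forall (uN_nonneg P n)) (integrable_const 1) (.of_forall ih)
      _ = 1 := by simp

theorem bddAbove_range_uN (n : ℕ) : BddAbove (Set.range (uN P A n)) :=
  ⟨1, Set.forall_mem_range.2 (uN_le_one P n)⟩

theorem integrable_uN (hA : MeasurableSet A) (n : ℕ) (x : X) : Integrable (uN P A n) (P x) := by
  refine Integrable.of_bound (measurable_uN P hA n).aestronglyMeasurable 1 (.of_forall fun y => ?_)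
  rw [Real.norm_of_nonneg (uN_nonneg P n y)]
  exact uN_le_one P n y

theorem uN_add_le (hA : MeasurableSet A) {m : ℕ} {ρ : ℝ} (hρ : ∀ x, uN P A m x ≤ ρ)
    (n : ℕ) (x : X) : uN P A (m + n) x ≤ ρ * uN P A n x := by
  induction n generalizing x with
  | zero =>
    by_cases hx : x ∈ A
    · simpa [uN, hx] using hρ x
    · simp [uN_eq_zero_of_notMem P hx]
  | succ n ih =>
    by_cases hx : x ∈ A
    · have h := integral_mono (integrable_uN P hA (m + n) x)
        ((integrable_uN P hA n x).const_mul ρ) ih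
      rw [integral_const_mul] at h
      simpa [← add_assoc, uN, invOp, transOp, hx] using h
    · simp [uN_eq_zero_of_notMem P hx]

theorem uN_le_pow (hA : MeasurableSet A) {m : ℕ} (hm : 0 < m) {ρ : ℝ} (hρ₀ : 0 ≤ ρ)
    (hρ : ∀ x, uN P A m x ≤ ρ) (n : ℕ) (x : X) : uN P A n x ≤ ρ ^ (n / m) := by
  induction n using Nat.strong_induction_on with
  | _ n ih =>
    rcases lt_or_ge n m with hn | hn
    · simpa [Nat.div_eq_of_lt hn] using uN_le_one P n x
    · calc uN P A n x = uN P A (m + (n - m)) x := by rw [Nat.add_sub_cancel' hn]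
        _ ≤ ρ * uN P A (n - m) x := uN_add_le P hA hρ _ x
        _ ≤ ρ * ρ ^ ((n - m) / m) := mul_le_mul_of_nonneg_left (ih _ (by omega)) hρ₀
        _ = ρ ^ (n / m) := by rw [Nat.div_eq_sub_div hm hn, pow_succ']

theorem uFun_eq_zero_of_le (hA : MeasurableSet A) {m : ℕ} (hm : 0 < m) {ρ : ℝ} (hρ₀ : 0 ≤ ρ)
    (hρ₁ : ρ < 1) (hρ : ∀ x, uN P A m x ≤ ρ) (x : X) : uFun P A x = 0 := by
  refine le_antisymm (ge_of_tendsto' (tendsto_pow_atTop_nhds_zero_of_lt_one hρ₀ hρ₁) fun k => ?_)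
    (Real.iInf_nonneg fun n => uN_nonneg P n x)
  have h := uN_le_pow P hA hm hρ₀ hρ (m * k) x
  rw [Nat.mul_div_cancel_left k hm] at h
  exact (ciInf_le ⟨0, Set.forall_mem_range.2 fun n => uN_nonneg P n x⟩ (m * k)).trans h

end InvarianceValue

/-- if `A` is nonempty and `m := m(A) < ∞`, with `ρ := ρ(A)`, then
`sup_x u_n(x;A) ≤ ρ^⌊n/m⌋` for every `n`, and consequently `u(·;A) ≡ 0`. -/
theorem stmt2 (P : Kernel X X) [IsMarkovKernel P] (A : Set X)
    (hA : MeasurableSet A) (hne : A.Nonempty)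
    (hfin : {k : ℕ | (⨆ x, uN P A k x) < 1}.Nonempty)
    (m : ℕ) (hm : m = sInf {k : ℕ | (⨆ x, uN P A k x) < 1})
    (ρ : ℝ) (hρ : ρ = ⨆ x, uN P A m x) :
    (∀ n : ℕ, (⨆ x, uN P A n x) ≤ ρ ^ (n / m)) ∧ (∀ x : X, uFun P A x = 0) := by
  have hle : ∀ x, uN P A m x ≤ ρ := fun x => hρ ▸ le_ciSup (bddAbove_range_uN P m) x
  have hρ₀ : 0 ≤ ρ := hρ ▸ Real.iSup_nonneg (uN_nonneg P m)
  have hρ₁ : ρ < 1 := by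
    rw [hρ, hm]
    exact Nat.sInf_mem hfin
  have hm₀ : 0 < m := by
    obtain ⟨x, hx⟩ := hne
    refine Nat.pos_of_ne_zero fun h => ?_
    have h₁ := hle x
    simp only [h, uN, Set.indicator_of_mem hx, Pi.one_apply] at h₁
    exact absurd hρ₁ h₁.not_gt
  have : Nonempty X := hne.to_type
  exact ⟨fun n => ciSup_le (uN_le_pow P hA hm₀ hρ₀ hle n),
    uFun_eq_zero_of_le P hA hm₀ hρ₀ hρ₁ hle⟩
end

section
/- Let A, B ∈ 𝓑 be disjoint, let g : X → ℝ be bounded, measurable and nonnegative, and let δ > 0 be such that {g < δ} ⊆ A and (Pg)(x) ≤ g(x) for every x ∈ {g < δ}. Then w(x;A,B) ≤ g(x)/δ for every x ∈ X. -/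
open MeasureTheory ProbabilityTheory

variable {X : Type*} [MeasurableSpace X]

lemma invOp_nonneg (P : Kernel X X) (A : Set X) {f : X → ℝ} (hf : ∀ x, 0 ≤ f x) (x : X) :
    0 ≤ invOp P A f x :=
  Set.indicator_nonneg (fun _ _ => integral_nonneg hf) x

lemma wN_nonneg (P : Kernel X X) (A B : Set X) (n : ℕ) (x : X) : 0 ≤ wN P A B n x := by
  have hB : ∀ x, 0 ≤ B.indicator (1 : X → ℝ) x :=
    Set.indicator_nonneg fun _ _ => zero_le_one
  induction n generalizing x with
  | zero => exact hB x
  | succ n ih => exact add_nonneg (hB x) (invOp_nonneg P _ ih x)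

lemma wN_le_one (P : Kernel X X) [IsMarkovKernel P] (A B : Set X) (n : ℕ) (x : X) :
    wN P A B n x ≤ 1 := by
  induction n generalizing x with
  | zero => exact Set.indicator_le' (fun _ _ => le_rfl) (fun _ _ => zero_le_one) x
  | succ n ih =>
    have hle : transOp P (wN P A B n) x ≤ 1 := by
      simpa [transOp] using integral_mono_of_nonneg (μ := P x)
        (ae_of_all _ (wN_nonneg P A B n)) (integrable_const (1 : ℝ)) (ae_of_all _ ih)
    change B.indicator 1 x + (A \ B).indicator (transOp P (wN P A B n)) x ≤ 1
    by_cases hxB : x ∈ B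
    · simp [hxB]
    · by_cases hxA : x ∈ A
      · simpa [hxA, hxB] using hle
      · simp [hxA, hxB]

/-- if `A, B` are disjoint, `g` is bounded, measurable, nonnegative, `δ > 0`
with `{g < δ} ⊆ A` and `(Pg)(x) ≤ g(x)` on `{g < δ}`, then `w(x;A,B) ≤ g(x)/δ` for every `x`. -/
theorem stmt12 (P : Kernel X X) [IsMarkovKernel P] (A B : Set X)
    (hA : MeasurableSet A) (hB : MeasurableSet B) (hAB : Disjoint A B)
    (g : X → ℝ) (hgm : Measurable g) (hgb : BddFun g) (hg0 : ∀ x, 0 ≤ g x)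
    (δ : ℝ) (hδ : 0 < δ)
    (hsub : {y | g y < δ} ⊆ A)
    (hexc : ∀ x, g x < δ → transOp P g x ≤ g x) :
    ∀ x : X, wFun P A B x ≤ g x / δ := by
  have hint : ∀ x, Integrable g (P x) := by
    obtain ⟨C, hC⟩ := hgb
    exact fun x => Integrable.of_bound hgm.aestronglyMeasurable C (ae_of_all _ hC)
  have hle : ∀ n x, wN P A B n x ≤ g x / δ := by
    intro n
    induction n with
    | zero =>
      intro x
      refine Set.indicator_le' (fun y hy => ?_) (fun y _ => div_nonneg (hg0 y) hδ.le) x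
      exact (one_le_div hδ).2 (not_lt.1 fun h => hAB.notMem_of_mem_left (hsub h) hy)
    | succ n ih =>
      intro x
      rcases le_or_gt δ (g x) with hx | hx
      · exact (wN_le_one P A B _ x).trans ((one_le_div hδ).2 hx)
      have hxA := hsub hx
      have hxB := hAB.notMem_of_mem_left hxA
      have hmono : transOp P (wN P A B n) x ≤ transOp P g x / δ := by
        rw [transOp, transOp, ← integral_div]
        exact integral_mono_of_nonneg (ae_of_all _ (wN_nonneg P A B n))
          ((hint x).div_const δ) (ae_of_all _ ih)
      change B.indicator 1 x + (A \ B).indicator (transOp P (wN P A B n)) x ≤ g x / δ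
      have hxAB : x ∈ A \ B := ⟨hxA, hxB⟩
      rw [Set.indicator_of_notMem hxB, Set.indicator_of_mem hxAB, zero_add]
      exact hmono.trans (div_le_div_of_nonneg_right (hexc x hx) hδ.le)
  exact fun x => ciSup_le fun n => hle n x
end
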